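/- Let G be a connected simple graph on vertices {0,...,n} with root r. There exists a bijection φ from parking functions of G to spanning trees of G rooted at r such that for every parking function P, the number of κ-inversions of φ(P) equals g - deg P, where g = |E| - |V| + 1. -/

import Mathlib

open Finset

namespace PFG

variable {n : ℕ}

/-- `deg_{Sᶜ}(i)`: the number of edges `{i,j}` of `G` with `j ∉ S`. -/
noncomputable def sDeg (G : SimpleGraph (Fin (n+1))) (S : Finset (Fin (n+1))) (i : Fin (n+1)) : ℕ :=
  Set.ncard {j : Fin (n+1) | G.Adj i j ∧ j ∉ S}

/-- `P` is a parking function for `G` with respect to the root `r`: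
for every nonempty `S ⊆ V \ {r}` there is `i ∈ S` with `P i < deg_{Sᶜ}(i)`. -/
def IsParkingFunction (G : SimpleGraph (Fin (n+1))) (r : Fin (n+1))
    (P : Fin (n+1) → ℕ) : Prop :=
  ∀ S : Finset (Fin (n+1)), S.Nonempty → r ∉ S → ∃ i ∈ S, P i < sDeg G S i

/-- The degree of a parking function: the sum of its values over non-root vertices. -/
def degPF (r : Fin (n+1)) (P : Fin (n+1) → ℕ) : ℕ := ∑ v ∈ univ.erase r, P v

/-- A spanning tree of `G` rooted at `r`, encoded by its parent function:
each non-root vertex is adjacent (in `G`) to its parent, and iterating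
the parent map from any vertex reaches the root. -/
structure RootedSpanningTree (G : SimpleGraph (Fin (n+1))) (r : Fin (n+1)) where
  parent : Fin (n+1) → Fin (n+1)
  parent_root : parent r = r
  adj_parent : ∀ v, v ≠ r → G.Adj (parent v) v
  reaches_root : ∀ v, ∃ k, parent^[k] v = r

/-- `i` is a (proper) ancestor of `j` in the rooted tree with parent map `par`. -/
def IsAncestor (par : Fin (n+1) → Fin (n+1)) (i j : Fin (n+1)) : Prop :=
  ∃ k, 0 < k ∧ par^[k] j = i

/-- An inversion: `i` is an ancestor of `j` and `i > j`. -/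
def IsInversion (par : Fin (n+1) → Fin (n+1)) (i j : Fin (n+1)) : Prop :=
  IsAncestor par i j ∧ j < i

/-- A κ-inversion: an inversion `(i,j)` such that moreover `i` is not the
root and the parent of `i` is adjacent to `j` in `G`. -/
def IsKappaInversion (G : SimpleGraph (Fin (n+1))) (r : Fin (n+1))
    (par : Fin (n+1) → Fin (n+1)) (i j : Fin (n+1)) : Prop :=
  IsAncestor par i j ∧ j < i ∧ i ≠ r ∧ G.Adj (par i) j

/-- the κ-number: the number of κ-inversions. -/
noncomputable def kappaNum (G : SimpleGraph (Fin (n+1))) (r : Fin (n+1))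
    (par : Fin (n+1) → Fin (n+1)) : ℕ :=
  Set.ncard {p : Fin (n+1) × Fin (n+1) | IsKappaInversion G r par p.1 p.2}

/-- the number of inversions. -/
noncomputable def invNum (par : Fin (n+1) → Fin (n+1)) : ℕ :=
  Set.ncard {p : Fin (n+1) × Fin (n+1) | IsInversion par p.1 p.2}

open Classical in
/-- The neighbors of `i` in `G`, listed in decreasing order. -/
noncomputable def nbrs (G : SimpleGraph (Fin (n+1))) (i : Fin (n+1)) : List (Fin (n+1)) :=
  ((univ.filter (fun j => G.Adj i j)).sort (· ≤ ·)).reverse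

/-- One step of depth-first search from vertex `i`: scan the neighbors of `i`
in decreasing order; each unvisited neighbor `j` is visited, gets parent `i`,
and the search recurses from `j`.  The state is the pair
(visited vertices, parent map). -/
noncomputable def dfsStep (G : SimpleGraph (Fin (n+1))) :
    ℕ → Fin (n+1) → Finset (Fin (n+1)) × (Fin (n+1) → Fin (n+1)) →
      Finset (Fin (n+1)) × (Fin (n+1) → Fin (n+1))
  | 0, _, st => st
  | (fuel+1), i, st =>
      (nbrs G i).foldl
        (fun st j =>
          if j ∈ st.1 then st
          else dfsStep G fuel j (insert j st.1, Function.update st.2 j i)) st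

/-- The parent map of the depth-first search tree of `G` rooted at `r`,
visiting neighbors in decreasing numerical order. -/
noncomputable def dfsParent (G : SimpleGraph (Fin (n+1))) (r : Fin (n+1)) :
    Fin (n+1) → Fin (n+1) :=
  (dfsStep G (n+1) r ({r}, fun _ => r)).2

/-- The set of edges of the rooted tree given by parent map `par`. -/
def treeEdges (r : Fin (n+1)) (par : Fin (n+1) → Fin (n+1)) : Set (Sym2 (Fin (n+1))) :=
  {e | ∃ v, v ≠ r ∧ e = s(par v, v)}

end PFG

namespace PFGProof
open PFG
open scoped Classical

/-- Number of remaining scans into `i` in the stack `L`. -/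
noncomputable def inR {n : ℕ} (G : SimpleGraph (Fin (n+1))) (L : List (Fin (n+1) × ℕ))
    (i : Fin (n+1)) : ℕ := (L.map (fun p => if G.Adj p.1 i ∧ i.val < p.2 then 1 else 0)).sum

noncomputable def outD {n : ℕ} (G : SimpleGraph (Fin (n+1))) (B S : Finset (Fin (n+1)))
    (i : Fin (n+1)) : ℕ := (univ.filter (fun x => G.Adj i x ∧ x ∉ B ∧ x ∉ S)).card

/-- Parking functions of a state. -/
def Pset {n : ℕ} (G : SimpleGraph (Fin (n+1))) (B : Finset (Fin (n+1)))
    (L : List (Fin (n+1) × ℕ)) : Set (Fin (n+1) → ℕ) :=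
  {P | (∀ v ∈ B, P v = 0) ∧ ∀ S : Finset (Fin (n+1)), S.Nonempty → (∀ i ∈ S, i ∉ B) →
    ∃ i ∈ S, P i < inR G L i + outD G B S i}

def IsTree {n : ℕ} (G : SimpleGraph (Fin (n+1))) (r : Fin (n+1))
    (T : Fin (n+1) → Fin (n+1)) : Prop :=
  T r = r ∧ (∀ v, v ≠ r → G.Adj (T v) v) ∧ ∀ v, ∃ k, T^[k] v = r

/-- Spanning trees compatible with a state. -/
def Tset {n : ℕ} (G : SimpleGraph (Fin (n+1))) (r : Fin (n+1)) (B : Finset (Fin (n+1)))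
    (par : Fin (n+1) → Fin (n+1)) (L : List (Fin (n+1) × ℕ)) :
    Set (Fin (n+1) → Fin (n+1)) :=
  {T | IsTree G r T ∧ (∀ v ∈ B, T v = par v) ∧
    ∀ v, v ∉ B → T v ∈ B → ∃ p ∈ L, p.1 = T v ∧ v.val < p.2}

/-- The stack is a path to the root. -/
inductive Chain {n : ℕ} (r : Fin (n+1)) (par : Fin (n+1) → Fin (n+1)) :
    List (Fin (n+1) × ℕ) → Prop
  | nil : Chain r par []
  | single (t : ℕ) : Chain r par [(r, t)]
  | cons (u w : Fin (n+1)) (t : ℕ) (rest : List (Fin (n+1) × ℕ)) (hu : u ≠ r) (hw : par u = w)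
      (h : Chain r par ((w, u.val) :: rest)) : Chain r par ((u, t) :: (w, u.val) :: rest)

structure Inv {n : ℕ} (G : SimpleGraph (Fin (n+1))) (r : Fin (n+1)) (B : Finset (Fin (n+1)))
    (par : Fin (n+1) → Fin (n+1)) (L : List (Fin (n+1) × ℕ)) : Prop where
  root : r ∈ B
  par_root : par r = r
  adj : ∀ v ∈ B, v ≠ r → G.Adj (par v) v
  closed : ∀ v ∈ B, par v ∈ B
  reach : ∀ v ∈ B, ∃ k, par^[k] v = r
  mem : ∀ p ∈ L, p.1 ∈ B
  nodup : (L.map Prod.fst).Nodup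
  chain : Chain r par L

noncomputable def kap {n : ℕ} (G : SimpleGraph (Fin (n+1))) (r : Fin (n+1))
    (B : Finset (Fin (n+1))) (T : Fin (n+1) → Fin (n+1)) : ℕ :=
  (univ.filter (fun p : Fin (n+1) × Fin (n+1) => p.2 ∉ B ∧ IsKappaInversion G r T p.1 p.2)).card

noncomputable def eB {n : ℕ} (G : SimpleGraph (Fin (n+1))) (B : Finset (Fin (n+1))) : ℕ :=
  (univ.filter (fun e : Sym2 (Fin (n+1)) => e ∈ G.edgeSet ∧ ∀ x ∈ e, x ∉ B)).card

noncomputable def Rc {n : ℕ} (G : SimpleGraph (Fin (n+1))) (B : Finset (Fin (n+1)))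
    (L : List (Fin (n+1) × ℕ)) : ℕ :=
  (L.map (fun p => (univ.filter (fun x : Fin (n+1) => x ∉ B ∧ G.Adj p.1 x ∧ x.val < p.2)).card)).sum

def Good {n : ℕ} (G : SimpleGraph (Fin (n+1))) (r : Fin (n+1)) (B : Finset (Fin (n+1)))
    (par : Fin (n+1) → Fin (n+1)) (L : List (Fin (n+1) × ℕ)) : Prop :=
  ∃ φ : (Fin (n+1) → ℕ) → (Fin (n+1) → Fin (n+1)),
    Set.BijOn φ (Pset G B L) (Tset G r B par L) ∧
    ∀ P ∈ Pset G B L, kap G r B (φ P) + ∑ v, P v + (Bᶜ).card = Rc G B L + eB G B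

variable {n : ℕ} {G : SimpleGraph (Fin (n+1))} {r : Fin (n+1)} {B : Finset (Fin (n+1))}
  {par : Fin (n+1) → Fin (n+1)} {L : List (Fin (n+1) × ℕ)}

theorem Chain.tail {p} (h : Chain r par (p :: L)) : Chain r par L := by
  cases h with
  | single => exact Chain.nil
  | cons => assumption

theorem Chain.head {u : Fin (n+1)} {t : ℕ} (t' : ℕ) (h : Chain r par ((u, t) :: L)) :
    Chain r par ((u, t') :: L) := by
  cases h with
  | single => exact Chain.single _
  | cons _ _ _ _ hu hw h => exact Chain.cons _ _ _ _ hu hw h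

theorem Chain.congr {par' : Fin (n+1) → Fin (n+1)} (h : Chain r par L)
    (hp : ∀ p ∈ L, par' p.1 = par p.1) : Chain r par' L := by
  induction h with
  | nil => exact Chain.nil
  | single => exact Chain.single _
  | cons u w t rest hu hw h ih =>
    refine Chain.cons _ _ _ _ hu ?_ (ih fun p hp' => hp p (List.mem_cons_of_mem _ hp'))
    rw [← hw]; exact hp (u, t) (by simp)

theorem Inv.tail {p} (h : Inv G r B par (p :: L)) : Inv G r B par L :=
  { h with
    mem := fun q hq => h.mem q (List.mem_cons_of_mem _ hq)
    nodup := by have := h.nodup; simp at this; exact this.2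
    chain := h.chain.tail }

theorem Inv.head {u : Fin (n+1)} {t : ℕ} (t' : ℕ) (h : Inv G r B par ((u, t) :: L)) :
    Inv G r B par ((u, t') :: L) :=
  { h with
    mem := fun q hq => by
      rcases List.mem_cons.1 hq with rfl | hq
      · exact h.mem (u, t) (by simp)
      · exact h.mem q (List.mem_cons_of_mem _ hq)
    nodup := by have := h.nodup; simpa using this
    chain := h.chain.head t' }

theorem iter_congr {f g : Fin (n+1) → Fin (n+1)} (hfg : ∀ v ∈ B, f v = g v)
    (hc : ∀ v ∈ B, g v ∈ B) (k : ℕ) : ∀ v ∈ B, f^[k] v = g^[k] v := by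
  induction k with
  | zero => intro v _; rfl
  | succ k ih => intro v hv; simp only [Function.iterate_succ, Function.comp]; rw [hfg v hv, ih _ (hc v hv)]

theorem Inv.push {u j : Fin (n+1)} {t : ℕ} (h : Inv G r B par ((u, t) :: L)) (hj : j ∉ B)
    (ha : G.Adj u j) :
    Inv G r (insert j B) (Function.update par j u) ((j, n+1) :: (u, j.val) :: L) := by
  have huB : u ∈ B := h.mem (u, t) (by simp)
  have hne : ∀ v ∈ B, v ≠ j := fun v hv e => hj (e ▸ hv)
  have hup : ∀ v ∈ B, Function.update par j u v = par v := fun v hv =>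
    Function.update_of_ne (hne v hv) _ _
  have h' := h.head j.val
  have hrea : ∀ v ∈ B, ∃ k, (Function.update par j u)^[k] v = r := fun v hv => by
    obtain ⟨k, hk⟩ := h.reach v hv
    exact ⟨k, by rw [iter_congr hup h.closed k v hv, hk]⟩
  refine ⟨by simp [h.root], by rw [hup r h.root, h.par_root], ?_, ?_, ?_, ?_, ?_, ?_⟩
  · intro v hv hvr
    rcases Finset.mem_insert.1 hv with rfl | hv
    · simpa using ha
    · rw [hup v hv]; exact h.adj v hv hvr
  · intro v hv
    rcases Finset.mem_insert.1 hv with rfl | hv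
    · simp [huB]
    · rw [hup v hv]; simp [h.closed v hv]
  · intro v hv
    rcases Finset.mem_insert.1 hv with rfl | hv
    · obtain ⟨k, hk⟩ := hrea u huB
      exact ⟨k+1, by simpa using hk⟩
    · exact hrea v hv
  · intro p hp
    rcases List.mem_cons.1 hp with rfl | hp
    · simp
    · exact Finset.mem_insert_of_mem (h'.mem p hp)
  · rw [List.map_cons, List.nodup_cons]
    refine ⟨fun hm => ?_, h'.nodup⟩
    obtain ⟨p, hp, hpj⟩ := List.mem_map.1 hm
    have hm := h'.mem p hp
    rw [hpj] at hm
    exact hj hm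
  · exact Chain.cons _ _ _ _ (hne r h.root).symm (by simp)
      (h'.chain.congr fun p hp => hup _ (h'.mem p hp))

theorem Pset_congr {L L'} (h : ∀ i, i ∉ B → inR G L i = inR G L' i) : Pset G B L = Pset G B L' := by
  ext P
  simp only [Pset, Set.mem_ofPred_eq]
  refine and_congr_right fun _ => forall_congr' fun S => forall_congr' fun _ => ?_
  refine forall_congr' fun hS => exists_congr fun i => and_congr_right fun hi => ?_
  rw [h i (hS i hi)]

theorem good_congr {L L'} (h1 : ∀ i, i ∉ B → inR G L i = inR G L' i)
    (h2 : Tset G r B par L = Tset G r B par L') (h3 : Rc G B L = Rc G B L')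
    (h : Good G r B par L') : Good G r B par L := by
  unfold Good at *
  rw [Pset_congr h1, h2, h3]; exact h

theorem good_pop {u : Fin (n+1)} (h : Good G r B par L) : Good G r B par ((u, 0) :: L) := by
  refine good_congr ?_ ?_ ?_ h
  · intro i _; simp [inR]
  · ext T; simp [Tset]
  · simp [Rc]

/-- useless scan -/
theorem good_skip {u : Fin (n+1)} {t : ℕ} (hr : r ∈ B)
    (hs : ∀ j : Fin (n+1), j.val = t → j ∉ B → ¬ G.Adj u j)
    (h : Good G r B par ((u, t) :: L)) : Good G r B par ((u, t+1) :: L) := by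
  have key : ∀ i, i ∉ B → (G.Adj u i ∧ i.val < t + 1 ↔ G.Adj u i ∧ i.val < t) := by
    intro i hi
    refine and_congr_right fun ha => ?_
    have : i.val ≠ t := fun e => hs i e hi ha
    omega
  refine good_congr ?_ ?_ ?_ h
  · intro i hi; simp only [inR, List.map_cons, List.sum_cons, key i hi]
  · ext T; simp only [Tset, Set.mem_ofPred_eq]
    refine and_congr_right fun hT => and_congr_right fun _ => forall_congr' fun v =>
      forall_congr' fun hv => forall_congr' fun _ => ?_
    have hvr : v ≠ r := fun e => hv (e ▸ hr)
    have ha := hT.2.1 v hvr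
    simp only [List.exists_mem_cons_iff]
    refine or_congr ?_ Iff.rfl
    refine and_congr_right fun e => ?_
    have := key v hv
    rw [e] at this
    tauto
  · simp only [Rc, List.map_cons, List.sum_cons]
    congr 2
    ext x; simp only [mem_filter, mem_univ, true_and]
    exact and_congr_right fun hx => key x hx

theorem good_nil (h : Inv G r B par []) : Good G r B par [] := by
  by_cases hB : B = univ
  · subst hB
    have hP : Pset G univ [] = {fun _ => 0} := by
      ext P; simp only [Pset, Set.mem_ofPred_eq, Set.mem_singleton_iff]
      constructor
      · intro h; funext v; exact h.1 v (mem_univ v)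
      · rintro rfl
        refine ⟨fun _ _ => rfl, ?_⟩
        rintro S ⟨x, hx⟩ hS
        exact absurd (mem_univ x) (hS x hx)
    have hT : Tset G r univ par [] = {par} := by
      ext T; simp only [Tset, Set.mem_ofPred_eq, Set.mem_singleton_iff]
      constructor
      · intro h; funext v; exact h.2.1 v (mem_univ v)
      · rintro rfl
        exact ⟨⟨h.par_root, fun v => h.adj v (mem_univ v), fun v => h.reach v (mem_univ v)⟩,
          fun _ _ => rfl, fun v hv => absurd (mem_univ v) hv⟩
    refine ⟨fun _ => par, ?_, ?_⟩
    · rw [hP, hT]; simp [Set.bijOn_singleton]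
    · rw [hP]; rintro P rfl
      have : eB G univ = 0 := by
        simp only [eB, Finset.card_eq_zero, Finset.filter_eq_empty_iff]
        rintro e - ⟨_, he⟩
        induction e with | _ a b => exact he a (by simp) (mem_univ a)
      simp [kap, Rc, this]
  · have hne : (Bᶜ).Nonempty := by
      rw [Finset.nonempty_iff_ne_empty]; simpa using hB
    have hP : Pset G B [] = ∅ := by
      rw [Set.eq_empty_iff_forall_notMem]
      rintro P ⟨_, hP⟩
      obtain ⟨i, hi, hlt⟩ := hP Bᶜ hne (by simp)
      simp [inR, outD] at hlt
    have hT : Tset G r B par [] = ∅ := by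
      rw [Set.eq_empty_iff_forall_notMem]
      rintro T ⟨⟨_, _, hre⟩, _, hT⟩
      have hstep : ∀ v, v ∉ B → T v ∉ B := fun v hv hTv => by
        obtain ⟨p, hp, _⟩ := hT v hv hTv
        simp at hp
      obtain ⟨v, hv⟩ := hne
      have : ∀ k, T^[k] v ∉ B := fun k => by
        induction k with
        | zero => simpa using hv
        | succ k ih => rw [Function.iterate_succ_apply']; exact hstep _ ih
      obtain ⟨k, hk⟩ := hre v
      exact this k (hk ▸ h.root)
    exact ⟨fun _ => par, by rw [hP, hT]; simp, by rw [hP]; simp⟩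

theorem Rc_insert {j : Fin (n+1)} (hj : j ∉ B) (L : List (Fin (n+1) × ℕ)) :
    Rc G B L = Rc G (insert j B) L + inR G L j := by
  induction L with
  | nil => simp [Rc, inR]
  | cons p L ih =>
    simp only [Rc, inR, List.map_cons, List.sum_cons] at ih ⊢
    have : (univ.filter (fun x : Fin (n+1) => x ∉ B ∧ G.Adj p.1 x ∧ x.val < p.2)).card =
      (univ.filter (fun x : Fin (n+1) => x ∉ insert j B ∧ G.Adj p.1 x ∧ x.val < p.2)).card
      + (if G.Adj p.1 j ∧ j.val < p.2 then 1 else 0) := by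
      split_ifs with hc
      · rw [← Finset.card_insert_of_notMem (a := j) (by simp)]
        congr 1; ext x
        simp only [mem_filter, mem_univ, true_and, Finset.mem_insert]
        by_cases hx : x = j
        · subst hx; simp [hj, hc]
        · simp [hx]
      · rw [add_zero]; congr 1; ext x
        simp only [mem_filter, mem_univ, true_and, Finset.mem_insert]
        by_cases hx : x = j
        · subst hx; simp [hc]
        · simp [hx]
    omega

theorem Rc_damp {u j : Fin (n+1)} (hj : j ∉ B) (ha : G.Adj u j) :
    Rc G B ((u, j.val+1) :: L) = Rc G B ((u, j.val) :: L) + 1 := by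
  simp only [Rc, List.map_cons, List.sum_cons]
  have : (univ.filter (fun x : Fin (n+1) => x ∉ B ∧ G.Adj u x ∧ x.val < j.val + 1)) =
      insert j (univ.filter (fun x : Fin (n+1) => x ∉ B ∧ G.Adj u x ∧ x.val < j.val)) := by
    ext x
    simp only [mem_filter, mem_univ, true_and, Finset.mem_insert]
    by_cases hx : x = j
    · subst hx; simp [hj, ha]
    · have : x.val ≠ j.val := fun e => hx (Fin.ext e)
      have : x.val < j.val + 1 ↔ x.val < j.val := by omega
      simp [hx, this]
  rw [this, Finset.card_insert_of_notMem (by simp)]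
  omega

theorem eB_insert {j : Fin (n+1)} (hj : j ∉ B) :
    eB G B = eB G (insert j B) + outD G (insert j B) ∅ j := by
  unfold eB outD
  rw [← Finset.card_image_of_injective (f := fun x => s(j, x)) (univ.filter (fun x => G.Adj j x ∧ x ∉ insert j B ∧ x ∉ (∅ : Finset (Fin (n+1)))))
    (fun a b h => Sym2.congr_right.1 h), ← Finset.card_union_of_disjoint]
  · congr 1
    ext e
    induction e with | _ a b =>
    simp only [mem_filter, mem_univ, true_and, Finset.mem_union, Finset.mem_image,
      Finset.mem_insert, SimpleGraph.mem_edgeSet, Sym2.mem_iff, Sym2.eq_iff]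
    constructor
    · rintro ⟨hab, h⟩
      have h1 := h a (by simp)
      have h2 := h b (by simp)
      by_cases haj : a = j
      · subst haj
        right; exact ⟨b, ⟨hab, by simp [hab.ne', h2]⟩, by simp⟩
      by_cases hbj : b = j
      · subst hbj
        right; exact ⟨a, ⟨hab.symm, by simp [haj, h1]⟩, by simp⟩
      left; refine ⟨hab, ?_⟩
      rintro x (rfl | rfl) <;> simp [*]
    · rintro (⟨hab, h⟩ | ⟨x, ⟨hx, hx1, -⟩, h | h⟩)
      · exact ⟨hab, fun x hx => fun hB => h x hx (Or.inr hB)⟩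
      · obtain ⟨rfl, rfl⟩ := h
        refine ⟨hx, ?_⟩
        rintro y (rfl | rfl)
        · exact hj
        · tauto
      · obtain ⟨rfl, rfl⟩ := h
        refine ⟨hx.symm, ?_⟩
        rintro y (rfl | rfl)
        · tauto
        · exact hj
  · rw [Finset.disjoint_left]
    intro e he he'
    simp only [mem_filter, mem_univ, true_and, Finset.mem_image] at he he'
    obtain ⟨x, _, rfl⟩ := he'
    exact he.2 j (by simp) (by simp)

theorem no_cycle {T : Fin (n+1) → Fin (n+1)} (hT : IsTree G r T) {u : Fin (n+1)} (hu : u ≠ r)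
    (k : ℕ) : T^[k] (T u) ≠ u := by
  intro h
  rw [← Function.iterate_succ_apply] at h
  have hper : ∀ m, T^[m * (k+1)] u = u := by
    intro m
    rw [mul_comm, Function.iterate_mul]
    exact Function.iterate_fixed h m
  obtain ⟨l, hl⟩ := hT.2.2 u
  have hr : ∀ m, T^[m] r = r := fun m => Function.iterate_fixed hT.1 m
  apply hu
  rw [← hper l, show l * (k+1) = l * k + l by ring, Function.iterate_add_apply, hl, hr]

/-- κ-inversions ending at `j` -/
theorem kappa_count {T : Fin (n+1) → Fin (n+1)} (hT : IsTree G r T) (j : Fin (n+1))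
    (hc : Chain r T L) : ∀ u t rest, L = (u, t) :: rest →
    (univ.filter (fun i => (∃ k, T^[k] u = i) ∧ j < i ∧ i ≠ r ∧ G.Adj (T i) j)).card
      = inR G rest j := by
  induction hc with
  | nil => intro u t rest h; simp at h
  | single t' =>
    intro u t rest h
    simp only [List.cons.injEq, Prod.mk.injEq] at h
    obtain ⟨⟨rfl, rfl⟩, rfl⟩ := h
    simp only [inR, List.map_nil, List.sum_nil, Finset.card_eq_zero, Finset.filter_eq_empty_iff]
    rintro i - ⟨⟨k, hk⟩, _, hi, _⟩
    rw [Function.iterate_fixed hT.1] at hk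
    exact hi hk.symm
  | cons u w t' rest hu hw h ih =>
    intro u' t rest' h'
    simp only [List.cons.injEq, Prod.mk.injEq] at h'
    obtain ⟨⟨rfl, rfl⟩, rfl⟩ := h'
    have ih := ih w u.val rest rfl
    simp only [inR, List.map_cons, List.sum_cons] at ih ⊢
    rw [← ih]
    have hanc : ∀ i, (∃ k, T^[k] u = i) ↔ i = u ∨ ∃ k, T^[k] w = i := by
      intro i
      constructor
      · rintro ⟨k, hk⟩
        cases k with
        | zero => left; exact hk.symm
        | succ k => right; exact ⟨k, by rw [← hw, ← hk]; rfl⟩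
      · rintro (rfl | ⟨k, hk⟩)
        · exact ⟨0, rfl⟩
        · exact ⟨k+1, by rw [← hk, ← hw]; rfl⟩
    have hnu : ¬ ∃ k, T^[k] w = u := by
      rintro ⟨k, hk⟩; rw [← hw] at hk; exact no_cycle hT hu k hk
    split_ifs with hif
    · rw [add_comm 1, ← Finset.card_insert_of_notMem (a := u)]
      · congr 1; ext i
        simp only [mem_filter, mem_univ, true_and, Finset.mem_insert, hanc]
        by_cases hi : i = u
        · subst hi; simp [hw, hif, hu, Fin.lt_def]
        · simp [hi]
      · simp only [mem_filter, mem_univ, true_and]; tauto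
    · rw [zero_add]
      congr 1; ext i
      simp only [mem_filter, mem_univ, true_and, hanc]
      by_cases hi : i = u
      · subst hi
        rw [hw]
        simp only [Fin.lt_def]
        tauto
      · simp [hi]

theorem kap_insert {T : Fin (n+1) → Fin (n+1)} {u j : Fin (n+1)} {t : ℕ} (hT : IsTree G r T)
    (hj : j ∉ B) (hu : T j = u) (hc : Chain r T ((u, t) :: L)) :
    kap G r B T = kap G r (insert j B) T + inR G L j := by
  rw [← kappa_count hT j hc u t L rfl]
  unfold kap
  rw [← Finset.card_image_of_injective (f := fun x => (x, j))
    (univ.filter (fun i => (∃ k, T^[k] u = i) ∧ j < i ∧ i ≠ r ∧ G.Adj (T i) j))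
    (fun a b h => by simpa using h), ← Finset.card_union_of_disjoint]
  · congr 1
    ext ⟨a, b⟩
    simp only [mem_filter, mem_univ, true_and, Finset.mem_union, Finset.mem_image,
      Finset.mem_insert, Prod.mk.injEq]
    simp only [IsKappaInversion, IsAncestor]
    have hanc : (∃ k, 0 < k ∧ T^[k] j = a) ↔ ∃ k, T^[k] u = a := by
      constructor
      · rintro ⟨k, hk, h⟩
        obtain ⟨k, rfl⟩ := Nat.exists_eq_succ_of_ne_zero hk.ne'
        exact ⟨k, by rw [← hu, ← h]; rfl⟩
      · rintro ⟨k, h⟩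
        exact ⟨k+1, by omega, by rw [← h, ← hu]; rfl⟩
    by_cases hb : b = j
    · subst hb
      simp [hj, hanc]
      constructor
      · rintro ⟨⟨k, rfl⟩, h⟩; exact ⟨k, h, rfl⟩
      · rintro ⟨k, h, rfl⟩; exact ⟨⟨k, rfl⟩, h⟩
    · simp [hb, Ne.symm hb]
  · rw [Finset.disjoint_left]
    intro e he he'
    simp only [mem_filter, mem_univ, true_and, Finset.mem_image] at he he'
    obtain ⟨x, _, rfl⟩ := he'
    exact he.1 (by simp)

theorem glue {α β : Type*} {A A' : Set α} {C C' D : Set β} {f g : α → β} {s : α → α} {E : Set α}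
    (q : α → Prop) [DecidablePred q]
    (hA : ∀ a, a ∈ E → q a → a ∈ A) (hA' : ∀ a ∈ A, a ∈ E ∧ q a)
    (hs : Set.BijOn s {a | a ∈ E ∧ ¬ q a} A')
    (hf : Set.BijOn f A C) (hg : Set.BijOn g A' C')
    (hD : ∀ d, d ∈ D ↔ d ∈ C ∨ d ∈ C') (hdis : Disjoint C C') :
    Set.BijOn (fun a => if q a then f a else g (s a)) E D := by
  rw [Set.disjoint_left] at hdis
  have hgs := hg.comp hs
  refine ⟨?_, ?_, ?_⟩
  · intro a ha
    by_cases hq : q a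
    · simp only [hq, if_true]; exact (hD _).2 (Or.inl (hf.mapsTo (hA a ha hq)))
    · simp only [hq, if_false]; exact (hD _).2 (Or.inr (hgs.mapsTo ⟨ha, hq⟩))
  · intro a ha b hb hab
    by_cases hq : q a <;> by_cases hq' : q b <;> simp only [hq, hq', if_true, if_false] at hab
    · exact hf.injOn (hA a ha hq) (hA b hb hq') hab
    · exact (hdis (hf.mapsTo (hA a ha hq)) (hab ▸ hgs.mapsTo (⟨hb, hq'⟩ : b ∈ {a | a ∈ E ∧ ¬ q a}))).elim
    · exact (hdis (hf.mapsTo (hA b hb hq')) (hab ▸ hgs.mapsTo (⟨ha, hq⟩ : a ∈ {a | a ∈ E ∧ ¬ q a}))).elim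
    · exact hgs.injOn (⟨ha, hq⟩ : a ∈ {a | a ∈ E ∧ ¬ q a}) ⟨hb, hq'⟩ hab
  · intro d hd
    rcases (hD d).1 hd with h | h
    · obtain ⟨a, ha, rfl⟩ := hf.surjOn h
      exact ⟨a, (hA' a ha).1, by simp [(hA' a ha).2]⟩
    · obtain ⟨a, ⟨ha, hq⟩, rfl⟩ := hgs.surjOn h
      exact ⟨a, ha, by simp [hq]⟩

theorem inR_damp {u j : Fin (n+1)} (ha : G.Adj u j) (i : Fin (n+1)) :
    inR G ((u, j.val+1) :: L) i = inR G ((u, j.val) :: L) i + if i = j then 1 else 0 := by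
  simp only [inR, List.map_cons, List.sum_cons]
  by_cases h : i = j
  · subst h; simp [ha]; omega
  · have : i.val ≠ j.val := fun e => h (Fin.ext e)
    have : i.val < j.val + 1 ↔ i.val < j.val := by omega
    simp [h, this]

theorem inR_push {j i : Fin (n+1)} :
    inR G ((j, n+1) :: L) i = inR G L i + if G.Adj j i then 1 else 0 := by
  simp only [inR, List.map_cons, List.sum_cons]
  have := i.isLt
  simp [this, add_comm]

theorem outD_insert {i j : Fin (n+1)} {S : Finset (Fin (n+1))} (hj : j ∉ B) (hS : j ∉ S) :
    outD G B S i = outD G (insert j B) S i + if G.Adj j i then 1 else 0 := by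
  unfold outD
  split_ifs with h
  · rw [← Finset.card_insert_of_notMem (a := j) (by simp)]
    congr 1; ext x
    simp only [mem_filter, mem_univ, true_and, Finset.mem_insert]
    by_cases hx : x = j
    · subst hx; simp [hj, hS, h.symm]
    · simp [hx]
  · rw [add_zero]; congr 1; ext x
    simp only [mem_filter, mem_univ, true_and, Finset.mem_insert]
    by_cases hx : x = j
    · subst hx; simp [G.adj_comm i x, h]
    · simp [hx]

theorem Pset_burn {u j : Fin (n+1)} (hj : j ∉ B) (ha : G.Adj u j) (P : Fin (n+1) → ℕ) :
    P ∈ Pset G (insert j B) ((j, n+1) :: (u, j.val) :: L) ↔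
      P ∈ Pset G B ((u, j.val+1) :: L) ∧ P j = 0 := by
  have key : ∀ S : Finset (Fin (n+1)), j ∉ S → ∀ i ∈ S,
      inR G ((j, n+1) :: (u, j.val) :: L) i + outD G (insert j B) S i =
      inR G ((u, j.val+1) :: L) i + outD G B S i := by
    intro S hS i hi
    have hij : i ≠ j := fun e => hS (e ▸ hi)
    rw [inR_push, inR_damp ha, outD_insert hj hS, if_neg hij]
    omega
  constructor
  · rintro ⟨h1, h2⟩
    have hj0 := h1 j (by simp)
    refine ⟨⟨fun v hv => h1 v (by simp [hv]), fun S hne hS => ?_⟩, hj0⟩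
    by_cases hjS : j ∈ S
    · refine ⟨j, hjS, ?_⟩
      rw [hj0, inR_damp ha]; simp
    · obtain ⟨i, hi, hlt⟩ := h2 S hne (fun i hi => by
        simp only [Finset.mem_insert, not_or]
        exact ⟨fun e => hjS (e ▸ hi), hS i hi⟩)
      exact ⟨i, hi, by rwa [key S hjS i hi] at hlt⟩
  · rintro ⟨⟨h1, h2⟩, hj0⟩
    refine ⟨fun v hv => ?_, fun S hne hS => ?_⟩
    · rcases Finset.mem_insert.1 hv with rfl | hv
      · exact hj0
      · exact h1 v hv
    · have hjS : j ∉ S := fun h => hS j h (by simp)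
      obtain ⟨i, hi, hlt⟩ := h2 S hne (fun i hi h => hS i hi (by simp [h]))
      exact ⟨i, hi, by rwa [key S hjS i hi]⟩

theorem Pset_damp {u j : Fin (n+1)} (hj : j ∉ B) (ha : G.Adj u j) (P P' : Fin (n+1) → ℕ)
    (hP : ∀ i, P i = P' i + if i = j then 1 else 0) :
    P ∈ Pset G B ((u, j.val+1) :: L) ↔ P' ∈ Pset G B ((u, j.val) :: L) := by
  simp only [Pset, Set.mem_ofPred_eq]
  refine and_congr (forall_congr' fun v => forall_congr' fun hv => ?_) ?_
  · have : v ≠ j := fun e => hj (e ▸ hv)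
    rw [hP v, if_neg this, add_zero]
  · refine forall_congr' fun S => forall_congr' fun _ => 
      forall_congr' fun hS => exists_congr fun i => and_congr_right fun hi => ?_
    rw [hP i, inR_damp ha]; omega

theorem Tset_burn {u j : Fin (n+1)} (hu : u ∈ B) (hj : j ∉ B) (T : Fin (n+1) → Fin (n+1)) :
    T ∈ Tset G r (insert j B) (Function.update par j u) ((j, n+1) :: (u, j.val) :: L) ↔
      T ∈ Tset G r B par ((u, j.val+1) :: L) ∧ T j = u := by
  constructor
  · rintro ⟨hT, h1, h2⟩
    have hTj : T j = u := by rw [h1 j (by simp)]; simp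
    refine ⟨⟨hT, fun v hv => ?_, fun v hv hTv => ?_⟩, hTj⟩
    · rw [h1 v (by simp [hv]), Function.update_of_ne (ne_of_mem_of_not_mem hv hj)]
    · by_cases hvj : v = j
      · subst hvj; exact ⟨(u, v.val+1), by simp, hTj.symm, by simp⟩
      · obtain ⟨p, hp, hp1, hp2⟩ := h2 v (by simp [hv, hvj]) (by simp [hTv])
        rcases List.mem_cons.1 hp with rfl | hp
        · simp only at hp1; rw [← hp1] at hTv; exact absurd hTv hj
        rcases List.mem_cons.1 hp with rfl | hp
        · exact ⟨(u, j.val+1), by simp, hp1, by simp only at hp2 ⊢; omega⟩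
        · exact ⟨p, by simp [hp], hp1, hp2⟩
  · rintro ⟨⟨hT, h1, h2⟩, hTj⟩
    refine ⟨hT, fun v hv => ?_, fun v hv hTv => ?_⟩
    · rcases Finset.mem_insert.1 hv with rfl | hv
      · simp [hTj]
      · rw [h1 v hv, Function.update_of_ne (ne_of_mem_of_not_mem hv hj)]
    · simp only [Finset.mem_insert, not_or] at hv
      rcases Finset.mem_insert.1 hTv with hTv | hTv
      · exact ⟨(j, n+1), by simp, hTv.symm, v.isLt⟩
      · obtain ⟨p, hp, hp1, hp2⟩ := h2 v hv.2 hTv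
        rcases List.mem_cons.1 hp with rfl | hp
        · have : v.val ≠ j.val := fun e => hv.1 (Fin.ext e)
          exact ⟨(u, j.val), by simp, hp1, by simp only at hp2 ⊢; omega⟩
        · exact ⟨p, by simp [hp], hp1, hp2⟩

theorem Tset_damp {u j : Fin (n+1)} (hu : u ∈ B) (hj : j ∉ B) (hnd : u ∉ L.map Prod.fst)
    (T : Fin (n+1) → Fin (n+1)) :
    T ∈ Tset G r B par ((u, j.val) :: L) ↔
      T ∈ Tset G r B par ((u, j.val+1) :: L) ∧ T j ≠ u := by
  constructor
  · rintro ⟨hT, h1, h2⟩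
    refine ⟨⟨hT, h1, fun v hv hTv => ?_⟩, fun hTj => ?_⟩
    · obtain ⟨p, hp, hp1, hp2⟩ := h2 v hv hTv
      rcases List.mem_cons.1 hp with rfl | hp
      · exact ⟨(u, j.val+1), by simp, hp1, by simp only at hp2 ⊢; omega⟩
      · exact ⟨p, by simp [hp], hp1, hp2⟩
    · obtain ⟨p, hp, hp1, hp2⟩ := h2 j hj (hTj ▸ hu)
      rcases List.mem_cons.1 hp with rfl | hp
      · simp at hp2
      · exact hnd (List.mem_map.2 ⟨p, hp, by rw [hp1, hTj]⟩)
  · rintro ⟨⟨hT, h1, h2⟩, hTj⟩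
    refine ⟨hT, h1, fun v hv hTv => ?_⟩
    obtain ⟨p, hp, hp1, hp2⟩ := h2 v hv hTv
    rcases List.mem_cons.1 hp with rfl | hp
    · have : v.val ≠ j.val := fun e => hTj (by rw [← Fin.ext e]; exact hp1.symm)
      exact ⟨(u, j.val), by simp, hp1, by simp only at hp2 ⊢; omega⟩
    · exact ⟨p, by simp [hp], hp1, hp2⟩

theorem good_branch {u j : Fin (n+1)} (hI : Inv G r B par ((u, j.val+1) :: L)) (hj : j ∉ B)
    (ha : G.Adj u j)
    (h1 : Good G r (insert j B) (Function.update par j u) ((j, n+1) :: (u, j.val) :: L))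
    (h2 : Good G r B par ((u, j.val) :: L)) : Good G r B par ((u, j.val+1) :: L) := by
  obtain ⟨f, hf, hfs⟩ := h1
  obtain ⟨g, hg, hgs⟩ := h2
  have huB : u ∈ B := hI.mem (u, j.val+1) (by simp)
  have hnd : u ∉ L.map Prod.fst := by
    have := hI.nodup
    rw [List.map_cons, List.nodup_cons] at this
    exact this.1
  let s : (Fin (n+1) → ℕ) → (Fin (n+1) → ℕ) := fun P i => P i - if i = j then 1 else 0
  have hsP : ∀ P : Fin (n+1) → ℕ, P j ≠ 0 → ∀ i, P i = s P i + if i = j then 1 else 0 := by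
    intro P hP i
    simp only [s]
    split_ifs with h
    · subst h; omega
    · simp
  refine ⟨fun P => if P j = 0 then f P else g (s P), ?_, ?_⟩
  · refine glue (fun P => P j = 0) (fun a h h' => (Pset_burn hj ha a).2 ⟨h, h'⟩)
      (fun a h => (Pset_burn hj ha a).1 h) ?_ hf hg ?_ ?_
    · refine ⟨?_, ?_, ?_⟩
      · rintro P ⟨hP, hq⟩
        exact (Pset_damp hj ha P (s P) (hsP P hq)).1 hP
      · rintro P ⟨hP, hq⟩ P' ⟨hP', hq'⟩ he
        funext i
        rw [hsP P hq, hsP P' hq', he]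
      · intro P' hP'
        have hrel : ∀ i, (fun i => P' i + if i = j then 1 else 0) i = P' i + if i = j then 1 else 0 :=
          fun i => rfl
        refine ⟨fun i => P' i + if i = j then 1 else 0, ⟨(Pset_damp hj ha _ P' hrel).2 hP', by simp⟩, ?_⟩
        funext i; simp [s]
    · intro T
      rw [Tset_burn huB hj, Tset_damp huB hj hnd]; tauto
    · rw [Set.disjoint_left]
      intro T hT hT'
      rw [Tset_burn huB hj] at hT
      rw [Tset_damp huB hj hnd] at hT'
      exact hT'.2 hT.2
  · intro P hP
    by_cases hq : P j = 0
    · simp only [hq, if_true]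
      have hP' := (Pset_burn hj ha P).2 ⟨hP, hq⟩
      have e1 := hfs P hP'
      have hT := hf.mapsTo hP'
      have hT2 := (Tset_burn huB hj _).1 hT
      have hch : Chain r (f P) ((u, j.val+1) :: L) :=
        hI.chain.congr fun p hp => hT2.1.2.1 p.1 (hI.mem p hp)
      rw [kap_insert hT.1 hj hT2.2 hch, Rc_damp hj ha, Rc_insert hj, eB_insert hj]
      have e2 : Rc G (insert j B) ((j, n+1) :: (u, j.val) :: L) =
          outD G (insert j B) ∅ j + Rc G (insert j B) ((u, j.val) :: L) := by
        simp only [Rc, outD, List.map_cons, List.sum_cons]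
        congr 2; ext x
        have := x.isLt
        simp only [mem_filter, mem_univ, true_and, this, Finset.notMem_empty, not_false_eq_true, and_true]
        tauto
      have e3 : inR G ((u, j.val) :: L) j = inR G L j := by simp [inR]
      have e4 : (Bᶜ).card = ((insert j B)ᶜ).card + 1 := by
        rw [Finset.compl_insert, Finset.card_erase_add_one (by simpa using hj)]
      omega
    · simp only [hq, if_false]
      have e1 := hgs _ ((Pset_damp hj ha P (s P) (hsP P hq)).1 hP)
      have e2 : ∑ v, P v = ∑ v, s P v + 1 := by
        rw [Finset.sum_congr rfl (fun i _ => hsP P hq i), Finset.sum_add_distrib]; simp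
      rw [Rc_damp hj ha]
      omega

theorem good_main : ∀ m : ℕ, ∀ (B : Finset (Fin (n+1))) (par : Fin (n+1) → Fin (n+1))
    (L : List (Fin (n+1) × ℕ)), (Bᶜ).card * (n+3) + (L.map Prod.snd).sum + L.length = m →
    Inv G r B par L → Good G r B par L := by
  intro m
  induction m using Nat.strong_induction_on with
  | _ m ih =>
  intro B par L hm hI
  match L, hm, hI with
  | [], _, hI => exact good_nil hI
  | (u, 0) :: L, hm, hI =>
    refine good_pop (ih _ ?_ B par L rfl hI.tail)
    simp at hm; omega
  | (u, t+1) :: L, hm, hI =>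
    simp only [List.map_cons, List.sum_cons, List.length_cons] at hm
    have h2 : Good G r B par ((u, t) :: L) := by
      refine ih _ ?_ B par _ rfl (hI.head t)
      simp only [List.map_cons, List.sum_cons, List.length_cons]; omega
    by_cases hs : ∀ j : Fin (n+1), j.val = t → j ∉ B → ¬ G.Adj u j
    · exact good_skip hI.root hs h2
    · push Not at hs
      obtain ⟨j, rfl, hj, ha⟩ := hs
      refine good_branch hI hj ha ?_ h2
      refine ih _ ?_ _ _ _ rfl (hI.push hj ha)
      have e4 : (Bᶜ).card = ((insert j B)ᶜ).card + 1 := by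
        rw [Finset.compl_insert, Finset.card_erase_add_one (by simpa using hj)]
      rw [e4, add_mul] at hm
      simp only [List.map_cons, List.sum_cons, List.length_cons]; omega

end PFGProof

/-- Main theorem: there is a bijection `φ` from parking functions of `G` to
spanning trees of `G` rooted at `r` with `κ(G, φ(P)) = g - deg P`, where
`g = |E| - |V| + 1` (stated additively: `κ(G, φ(P)) + deg P + |V| = |E| + 1`). -/
theorem parking_functions_equiv_spanning_trees_kappa {n : ℕ}
    (G : SimpleGraph (Fin (n+1))) (hG : G.Connected) (r : Fin (n+1)) :
    ∃ φ : {P : Fin (n+1) → ℕ // P r = 0 ∧ PFG.IsParkingFunction G r P} ≃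
        PFG.RootedSpanningTree G r,
      ∀ P, PFG.kappaNum G r (φ P).parent + PFG.degPF r P.1 + (n + 1) =
        G.edgeSet.ncard + 1 := by
  classical
  have hI : PFGProof.Inv G r {r} (fun _ => r) [(r, n+1)] := by
    refine ⟨by simp, rfl, by simp, by simp, ?_, by simp, by simp, PFGProof.Chain.single _⟩
    intro v hv
    exact ⟨1, rfl⟩
  obtain ⟨φ, hφ, hst⟩ := PFGProof.good_main (G := G) (r := r) _ {r} (fun _ => r) [(r, n+1)] rfl hI
  have hPs : ∀ P : Fin (n+1) → ℕ, P ∈ PFGProof.Pset G {r} [(r, n+1)] ↔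
      P r = 0 ∧ PFG.IsParkingFunction G r P := by
    intro P
    simp only [PFGProof.Pset, Set.mem_ofPred_eq, PFG.IsParkingFunction, Finset.mem_singleton,
      forall_eq]
    refine and_congr_right fun _ => forall_congr' fun S => forall_congr' fun _ => ?_
    refine imp_congr_ctx ?_ ?_
    · exact ⟨fun h hr => h r hr rfl, fun h i hi e => h (e ▸ hi)⟩
    · intro hr
      refine exists_congr fun i => and_congr_right fun hi => ?_
      have : PFG.sDeg G S i =
          PFGProof.inR G [(r, n+1)] i + PFGProof.outD G {r} S i := by
        have h1 : PFG.sDeg G S i = PFGProof.outD G ∅ S i := by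
          unfold PFG.sDeg PFGProof.outD
          rw [← Set.ncard_coe_finset]; congr 1; ext x; simp
        rw [h1, PFGProof.outD_insert (j := r) (by simp) hr, PFGProof.inR_push]
        simp [PFGProof.inR, add_comm]
      rw [this]
  have hTs : ∀ T : Fin (n+1) → Fin (n+1), T ∈ PFGProof.Tset G r {r} (fun _ => r) [(r, n+1)] ↔
      PFGProof.IsTree G r T := by
    intro T
    simp only [PFGProof.Tset, Set.mem_ofPred_eq, Finset.mem_singleton, forall_eq]
    refine ⟨fun h => h.1, fun h => ⟨h, h.1, fun v _ hv => ⟨(r, n+1), by simp, hv.symm, v.isLt⟩⟩⟩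
  let F : {P : Fin (n+1) → ℕ // P r = 0 ∧ PFG.IsParkingFunction G r P} →
      PFG.RootedSpanningTree G r := fun P =>
    have h := (hTs _).1 (hφ.mapsTo ((hPs P.1).2 P.2))
    ⟨φ P.1, h.1, h.2.1, h.2.2⟩
  have hF : Function.Bijective F := by
    constructor
    · intro P Q h
      have h' : φ P.1 = φ Q.1 := congrArg PFG.RootedSpanningTree.parent h
      exact Subtype.ext (hφ.injOn ((hPs P.1).2 P.2) ((hPs Q.1).2 Q.2) h')
    · rintro ⟨T, h1, h2, h3⟩
      obtain ⟨P, hP, rfl⟩ := hφ.surjOn ((hTs T).2 ⟨h1, h2, h3⟩)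
      exact ⟨⟨P, (hPs P).1 hP⟩, rfl⟩
  refine ⟨Equiv.ofBijective F hF, fun P => ?_⟩
  have hP := (hPs P.1).2 P.2
  have hT := (hTs _).1 (hφ.mapsTo hP)
  have e := hst P.1 hP
  have e1 : PFG.kappaNum G r (φ P.1) = PFGProof.kap G r {r} (φ P.1) := by
    unfold PFG.kappaNum PFGProof.kap
    rw [← Set.ncard_coe_finset]; congr 1; ext ⟨i, j⟩
    simp only [Set.mem_ofPred_eq, Finset.coe_filter, Finset.mem_univ, true_and,
      Finset.mem_singleton]
    refine ⟨fun h => ⟨?_, h⟩, fun h => h.2⟩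
    rintro rfl
    obtain ⟨⟨k, _, hk⟩, _, hi, _⟩ := h
    rw [Function.iterate_fixed hT.1] at hk
    exact hi hk.symm
  have e2 : PFG.degPF r P.1 = ∑ v, P.1 v := by
    unfold PFG.degPF
    rw [← Finset.add_sum_erase _ _ (Finset.mem_univ r), P.2.1, zero_add]
  have e3 : G.edgeSet.ncard = PFGProof.eB G ∅ := by
    unfold PFGProof.eB
    rw [← Set.ncard_coe_finset]; congr 1; ext x; simp
  have e4 : PFGProof.eB G ∅ = PFGProof.eB G {r} + PFGProof.outD G {r} ∅ r :=
    PFGProof.eB_insert (by simp)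
  have e5 : PFGProof.Rc G {r} [(r, n+1)] = PFGProof.outD G {r} ∅ r := by
    simp only [PFGProof.Rc, PFGProof.outD, List.map_cons, List.map_nil, List.sum_cons,
      List.sum_nil, add_zero]
    congr 1; ext x
    have := x.isLt
    simp only [Finset.mem_filter, Finset.mem_univ, true_and, this, Finset.notMem_empty,
      not_false_eq_true, and_true]
    tauto
  have e6 : (({r} : Finset (Fin (n+1)))ᶜ).card = n := by
    rw [Finset.card_compl]; simp
  have e0 : ((Equiv.ofBijective F hF) P).parent = φ P.1 := rfl
  rw [e0, e1, e2, e3]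
  omega
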